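/- arXiv:1010.4221 — 3 statements merged into one kernel-verified Lean document; each statement's English description precedes it below -/
import Mathlib

section
/- Fix real k₁, k₂ with −1/2 < k₁ < 1/2 and −1/2 < k₂ < 1/2. Then for all n, m, l, k ∈ ℕ the biorthogonality relation ⟨Ψ_{n,l}, φ_{m,k}⟩ = δ_{n,m} δ_{l,k} holds, where ⟨u,v⟩ = ∫_{ℝ²} conj(u(x,y)) v(x,y) dx dy. -/
open MeasureTheory

/-- Partial derivative in the `x`-direction of a function on `ℝ²`. -/
noncomputable def pdx (f : ℝ × ℝ → ℂ) : ℝ × ℝ → ℂ := fun p => fderiv ℝ f p (1, 0)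

/-- Partial derivative in the `y`-direction of a function on `ℝ²`. -/
noncomputable def pdy (f : ℝ × ℝ → ℂ) : ℝ × ℝ → ℂ := fun p => fderiv ℝ f p (0, 1)

/-- `B f = (1/√2)(−i ∂ₓ f − ∂_y f + ((i x/2)(1−2k₂) + (y/2)(1+2k₁)) f)`. -/
noncomputable def Bgll (k₁ k₂ : ℝ) (f : ℝ × ℝ → ℂ) : ℝ × ℝ → ℂ := fun p =>
  (Real.sqrt 2 : ℂ)⁻¹ * (-Complex.I * pdx f p - pdy f p +
    ((Complex.I * (p.1 : ℂ) / 2) * (1 - 2 * (k₂ : ℂ)) +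
      ((p.2 : ℂ) / 2) * (1 + 2 * (k₁ : ℂ))) * f p)

/-- `B′ f = (1/√2)(−∂ₓ f − i ∂_y f + ((x/2)(1−2k₂) + (i y/2)(1+2k₁)) f)`. -/
noncomputable def B'gll (k₁ k₂ : ℝ) (f : ℝ × ℝ → ℂ) : ℝ × ℝ → ℂ := fun p =>
  (Real.sqrt 2 : ℂ)⁻¹ * (-pdx f p - Complex.I * pdy f p +
    (((p.1 : ℂ) / 2) * (1 - 2 * (k₂ : ℂ)) +
      (Complex.I * (p.2 : ℂ) / 2) * (1 + 2 * (k₁ : ℂ))) * f p)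

/-- `A† f = (1/√2)(−i ∂ₓ f − ∂_y f + ((i x/2)(1+2k₂) + (y/2)(1−2k₁)) f)`. -/
noncomputable def Adag (k₁ k₂ : ℝ) (f : ℝ × ℝ → ℂ) : ℝ × ℝ → ℂ := fun p =>
  (Real.sqrt 2 : ℂ)⁻¹ * (-Complex.I * pdx f p - pdy f p +
    ((Complex.I * (p.1 : ℂ) / 2) * (1 + 2 * (k₂ : ℂ)) +
      ((p.2 : ℂ) / 2) * (1 - 2 * (k₁ : ℂ))) * f p)

/-- `A′† f = (1/√2)(−∂ₓ f − i ∂_y f + ((x/2)(1+2k₂) + (i y/2)(1−2k₁)) f)`. -/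
noncomputable def A'dag (k₁ k₂ : ℝ) (f : ℝ × ℝ → ℂ) : ℝ × ℝ → ℂ := fun p =>
  (Real.sqrt 2 : ℂ)⁻¹ * (-pdx f p - Complex.I * pdy f p +
    (((p.1 : ℂ) / 2) * (1 + 2 * (k₂ : ℂ)) +
      (Complex.I * (p.2 : ℂ) / 2) * (1 - 2 * (k₁ : ℂ))) * f p)

/-- `φ₀₀(x,y) = (2π)^{−1/2} exp(−(1+2k₂)x²/4 − (1−2k₁)y²/4)`. -/
noncomputable def phi00 (k₁ k₂ : ℝ) : ℝ × ℝ → ℂ := fun p =>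
  (Real.sqrt (2 * Real.pi) : ℂ)⁻¹ *
    Complex.exp (-(1 + 2 * (k₂ : ℂ)) * (p.1 : ℂ) ^ 2 / 4 -
      (1 - 2 * (k₁ : ℂ)) * (p.2 : ℂ) ^ 2 / 4)

/-- `Ψ₀₀(x,y) = (2π)^{−1/2} exp(−(1−2k₂)x²/4 − (1+2k₁)y²/4)`. -/
noncomputable def psi00 (k₁ k₂ : ℝ) : ℝ × ℝ → ℂ := fun p =>
  (Real.sqrt (2 * Real.pi) : ℂ)⁻¹ *
    Complex.exp (-(1 - 2 * (k₂ : ℂ)) * (p.1 : ℂ) ^ 2 / 4 -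
      (1 + 2 * (k₁ : ℂ)) * (p.2 : ℂ) ^ 2 / 4)

/-- `φ_{n,l} = (n! l!)^{−1/2} B′ⁿ Bˡ φ₀₀`. -/
noncomputable def phiNL (k₁ k₂ : ℝ) (n l : ℕ) : ℝ × ℝ → ℂ := fun p =>
  (Real.sqrt (n.factorial * l.factorial) : ℂ)⁻¹ *
    ((B'gll k₁ k₂)^[n] ((Bgll k₁ k₂)^[l] (phi00 k₁ k₂)) p)

/-- `Ψ_{n,l} = (n! l!)^{−1/2} (A′†)ⁿ (A†)ˡ Ψ₀₀`. -/
noncomputable def psiNL (k₁ k₂ : ℝ) (n l : ℕ) : ℝ × ℝ → ℂ := fun p =>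
  (Real.sqrt (n.factorial * l.factorial) : ℂ)⁻¹ *
    ((A'dag k₁ k₂)^[n] ((Adag k₁ k₂)^[l] (psi00 k₁ k₂)) p)

open MvPolynomial

namespace BiorthogonalHermite

/-! ### Ladder operators on polynomials in two variables -/

/-- The raising operator `u (x - ∂ₓ) + v (y - ∂_y)` on polynomials. -/
noncomputable def raise (u v : ℂ) (P : MvPolynomial (Fin 2) ℂ) : MvPolynomial (Fin 2) ℂ :=
  C u * (X 0 * P - pderiv 0 P) + C v * (X 1 * P - pderiv 1 P)

/-- The lowering operator `u ∂ₓ + v ∂_y` on polynomials. -/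
noncomputable def lower (u v : ℂ) (P : MvPolynomial (Fin 2) ℂ) : MvPolynomial (Fin 2) ℂ :=
  C u * pderiv 0 P + C v * pderiv 1 P

lemma pderiv_comm {R σ : Type*} [CommRing R] (i j : σ) (P : MvPolynomial σ R) :
    pderiv i (pderiv j P) = pderiv j (pderiv i P) := by
  classical
  have h : ⁅pderiv (R := R) i, pderiv (R := R) j⁆ =
      (0 : Derivation R (MvPolynomial σ R) (MvPolynomial σ R)) := by
    refine MvPolynomial.derivation_ext fun k => ?_
    simp only [Derivation.commutator_apply, pderiv_X, Derivation.coe_zero, Pi.zero_apply]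
    simp only [Pi.single_apply]
    split_ifs <;> simp
  have := DFunLike.congr_fun h P
  rwa [Derivation.commutator_apply, Derivation.coe_zero, Pi.zero_apply, sub_eq_zero] at this

lemma lower_raise (u v u' v' : ℂ) (P : MvPolynomial (Fin 2) ℂ) :
    lower u' v' (raise u v P) = raise u v (lower u' v' P) + C (u' * u + v' * v) * P := by
  simp only [lower, raise, map_add, map_sub, pderiv_mul, pderiv_C, pderiv_X_self,
    pderiv_X_of_ne (show (1 : Fin 2) ≠ 0 by decide),
    pderiv_X_of_ne (show (0 : Fin 2) ≠ 1 by decide), pderiv_comm (1 : Fin 2) 0, map_mul]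
  ring

lemma raise_C_mul (u v a : ℂ) (P : MvPolynomial (Fin 2) ℂ) :
    raise u v (C a * P) = C a * raise u v P := by
  simp only [raise, pderiv_C_mul]
  ring

lemma raise_add (u v : ℂ) (P Q : MvPolynomial (Fin 2) ℂ) :
    raise u v (P + Q) = raise u v P + raise u v Q := by
  simp only [raise, map_add]
  ring

lemma iterate_raise_C_mul (u v a : ℂ) (n : ℕ) (P : MvPolynomial (Fin 2) ℂ) :
    (raise u v)^[n] (C a * P) = C a * (raise u v)^[n] P := by
  induction n with
  | zero => rfl
  | succ n ih => simp only [Function.iterate_succ_apply', ih, raise_C_mul]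

lemma iterate_raise_zero (u v : ℂ) (n : ℕ) : (raise u v)^[n] 0 = 0 := by
  simpa using iterate_raise_C_mul u v 0 n 0

lemma lower_iterate_raise (u v u' v' : ℂ) (n : ℕ) (P : MvPolynomial (Fin 2) ℂ) :
    lower u' v' ((raise u v)^[n] P) = (raise u v)^[n] (lower u' v' P) +
      C (n * (u' * u + v' * v)) * (raise u v)^[n - 1] P := by
  induction n with
  | zero => simp
  | succ n ih =>
    rw [Function.iterate_succ_apply', lower_raise, ih, raise_add, raise_C_mul,
      Function.iterate_succ_apply', Nat.add_sub_cancel]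
    rcases n with _ | n
    · simp
    · rw [Nat.add_sub_cancel, ← Function.iterate_succ_apply' (raise u v) n P, Nat.succ_eq_add_one]
      push_cast
      simp only [map_mul, map_add, map_one]
      ring

lemma lower_one (u v : ℂ) : lower u v 1 = 0 := by
  simp [lower]

/-- Coefficientwise complex conjugation. -/
noncomputable abbrev conjPoly : MvPolynomial (Fin 2) ℂ →+* MvPolynomial (Fin 2) ℂ :=
  MvPolynomial.map (starRingEnd ℂ)

section Functional

variable (L : MvPolynomial (Fin 2) ℂ →ₗ[ℂ] ℂ)

lemma map_C_mul_eq (a : ℂ) (P : MvPolynomial (Fin 2) ℂ) : L (C a * P) = a * L P := by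
  rw [← smul_eq_C_mul, map_smul, smul_eq_mul]

lemma map_raise_eq_zero (hL : ∀ i P, L (X i * P) = L (pderiv i P)) (u v : ℂ)
    (P : MvPolynomial (Fin 2) ℂ) : L (raise u v P) = 0 := by
  simp [raise, map_C_mul_eq, hL]

/-- A functional satisfying Stein's identity makes the lowering operators adjoint to the raising
operators. -/
lemma map_conj_raise_mul (hL : ∀ i P, L (X i * P) = L (pderiv i P))
    (u v : ℂ) (P Q : MvPolynomial (Fin 2) ℂ) :
    L (conjPoly (raise u v P) * Q) =
      L (conjPoly P * lower (starRingEnd ℂ u) (starRingEnd ℂ v) Q) := by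
  have h : conjPoly (raise u v P) * Q =
      raise (starRingEnd ℂ u) (starRingEnd ℂ v) (conjPoly P * Q) +
        conjPoly P * lower (starRingEnd ℂ u) (starRingEnd ℂ v) Q := by
    simp only [raise, lower, map_add, map_mul, map_sub, map_C, map_X, pderiv_mul, conjPoly,
      pderiv_map]
    ring
  rw [h, map_add, map_raise_eq_zero L hL, zero_add]

lemma map_conj_iterate_raise_mul (hL : ∀ i P, L (X i * P) = L (pderiv i P))
    (h1 : L 1 = 1) (u v u' v' : ℂ)
    (hu : starRingEnd ℂ u * u + starRingEnd ℂ v * v = 1)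
    (hu' : starRingEnd ℂ u' * u' + starRingEnd ℂ v' * v' = 1)
    (huu' : starRingEnd ℂ u * u' + starRingEnd ℂ v * v' = 0) (n m l k : ℕ) :
    L (conjPoly ((raise u v)^[n] ((raise u' v')^[l] 1)) *
      (raise u v)^[m] ((raise u' v')^[k] 1)) =
      if n = m ∧ l = k then (n.factorial * l.factorial : ℂ) else 0 := by
  have hu'u : starRingEnd ℂ u' * u + starRingEnd ℂ v' * v = 0 := by
    have := congrArg (starRingEnd ℂ) huu'
    simp only [map_add, map_mul, Complex.conj_conj, map_zero] at this
    linear_combination this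
  induction n generalizing m with
  | zero =>
    induction l generalizing k with
    | zero =>
      rcases m with _ | m
      · rcases k with _ | k
        · simp [h1]
        · simp [Function.iterate_succ_apply', map_raise_eq_zero L hL, -Function.iterate_succ]
      · simp [Function.iterate_succ_apply', map_raise_eq_zero L hL, -Function.iterate_succ]
    | succ l ih =>
      rw [Function.iterate_zero_apply] at ih ⊢
      rw [Function.iterate_succ_apply', map_conj_raise_mul L hL, lower_iterate_raise, hu'u,
        mul_zero, map_zero, zero_mul, add_zero, lower_iterate_raise, lower_one, hu',
        iterate_raise_zero, zero_add, mul_one, iterate_raise_C_mul, mul_left_comm, map_C_mul_eq,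
        ih]
      rcases k with _ | k
      · simp
      · rw [Nat.add_sub_cancel]
        by_cases h : 0 = m ∧ l = k
        · obtain ⟨rfl, rfl⟩ := h
          simp [Nat.factorial_succ]
        · rw [if_neg h, if_neg (by simpa using h), mul_zero]
  | succ n ih =>
    rw [Function.iterate_succ_apply', map_conj_raise_mul L hL, lower_iterate_raise, hu, mul_one,
      lower_iterate_raise, lower_one, huu', mul_zero, map_zero, zero_mul, add_zero,
      iterate_raise_zero, iterate_raise_zero, zero_add, mul_left_comm, map_C_mul_eq, ih]
    rcases m with _ | m
    · simp
    · rw [Nat.add_sub_cancel]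
      by_cases h : n = m ∧ l = k
      · obtain ⟨rfl, rfl⟩ := h
        simp [Nat.factorial_succ, mul_assoc]
      · rw [if_neg h, if_neg (by simpa using h), mul_zero]

end Functional

/-! ### Polynomials times Gaussians -/

/-- The Gaussian `(2π)^{-1/2} exp(-s x²/4 - t y²/4)`. -/
noncomputable def gauss (s t : ℂ) : ℝ × ℝ → ℂ := fun p =>
  (Real.sqrt (2 * Real.pi) : ℂ)⁻¹ *
    Complex.exp (-s * (p.1 : ℂ) ^ 2 / 4 - t * (p.2 : ℂ) ^ 2 / 4)

/-- Evaluation of a complex polynomial at a point of the real plane. -/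
noncomputable def evalAt (p : ℝ × ℝ) : MvPolynomial (Fin 2) ℂ →+* ℂ :=
  eval ![(p.1 : ℂ), (p.2 : ℂ)]

/-- A polynomial times a Gaussian. -/
noncomputable def polyGauss (s t : ℂ) (P : MvPolynomial (Fin 2) ℂ) : ℝ × ℝ → ℂ := fun p =>
  evalAt p P * gauss s t p

@[simp] lemma evalAt_C (p : ℝ × ℝ) (a : ℂ) : evalAt p (C a) = a := by simp [evalAt]

@[simp] lemma evalAt_X_zero (p : ℝ × ℝ) : evalAt p (X 0) = p.1 := by simp [evalAt]

@[simp] lemma evalAt_X_one (p : ℝ × ℝ) : evalAt p (X 1) = p.2 := by simp [evalAt]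

lemma evalAt_conjPoly (p : ℝ × ℝ) (P : MvPolynomial (Fin 2) ℂ) :
    evalAt p (conjPoly P) = starRingEnd ℂ (evalAt p P) := by
  induction P using MvPolynomial.induction_on with
  | C a => simp
  | add P Q hP hQ => simp [hP, hQ]
  | mul_X P i hP => fin_cases i <;> simp_all

/-- The complexified first coordinate, as a continuous linear map. -/
noncomputable abbrev coordX : ℝ × ℝ →L[ℝ] ℂ :=
  Complex.ofRealCLM.comp (ContinuousLinearMap.fst ℝ ℝ ℝ)

/-- The complexified second coordinate, as a continuous linear map. -/
noncomputable abbrev coordY : ℝ × ℝ →L[ℝ] ℂ :=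
  Complex.ofRealCLM.comp (ContinuousLinearMap.snd ℝ ℝ ℝ)

lemma hasFDerivAt_coordX (p : ℝ × ℝ) : HasFDerivAt (fun q : ℝ × ℝ => (q.1 : ℂ)) coordX p :=
  coordX.hasFDerivAt

lemma hasFDerivAt_coordY (p : ℝ × ℝ) : HasFDerivAt (fun q : ℝ × ℝ => (q.2 : ℂ)) coordY p :=
  coordY.hasFDerivAt

lemma hasFDerivAt_evalAt (P : MvPolynomial (Fin 2) ℂ) (p : ℝ × ℝ) :
    HasFDerivAt (fun q => evalAt q P)
      (evalAt p (pderiv 0 P) • coordX + evalAt p (pderiv 1 P) • coordY) p := by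
  induction P using MvPolynomial.induction_on with
  | C a =>
    simp only [evalAt_C, pderiv_C, map_zero]
    refine (hasFDerivAt_const a p).congr_fderiv ?_
    ext <;> simp
  | add P Q hP hQ =>
    simp only [map_add]
    refine (hP.add hQ).congr_fderiv ?_
    ext <;> simp
  | mul_X P i hP =>
    fin_cases i
    · simp only [Fin.zero_eta, map_mul, evalAt_X_zero]
      refine (hP.mul (hasFDerivAt_coordX p)).congr_fderiv ?_
      ext <;> simp [pderiv_X_of_ne (show (0 : Fin 2) ≠ 1 by decide)]
    · simp only [Fin.mk_one, map_mul, evalAt_X_one]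
      refine (hP.mul (hasFDerivAt_coordY p)).congr_fderiv ?_
      ext <;> simp [pderiv_X_of_ne (show (1 : Fin 2) ≠ 0 by decide)]

lemma hasFDerivAt_gauss (s t : ℂ) (p : ℝ × ℝ) :
    HasFDerivAt (gauss s t)
      ((-s / 2 * p.1 * gauss s t p) • coordX + (-t / 2 * p.2 * gauss s t p) • coordY) p := by
  have h := ((((hasFDerivAt_coordX p).pow 2).const_mul (-s / 4)).sub
    (((hasFDerivAt_coordY p).pow 2).const_mul (t / 4))).cexp.const_mul
      (Real.sqrt (2 * Real.pi) : ℂ)⁻¹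
  have he : gauss s t = fun q : ℝ × ℝ => (Real.sqrt (2 * Real.pi) : ℂ)⁻¹ *
      Complex.exp (-s / 4 * (q.1 : ℂ) ^ 2 - t / 4 * (q.2 : ℂ) ^ 2) := by
    funext q
    simp only [gauss]
    ring_nf
  rw [he]
  refine h.congr_fderiv ?_
  ext <;> simp <;> ring

lemma hasFDerivAt_polyGauss (s t : ℂ) (P : MvPolynomial (Fin 2) ℂ) (p : ℝ × ℝ) :
    HasFDerivAt (polyGauss s t P)
      (polyGauss s t (pderiv 0 P - C (s / 2) * X 0 * P) p • coordX +
        polyGauss s t (pderiv 1 P - C (t / 2) * X 1 * P) p • coordY) p := by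
  refine ((hasFDerivAt_evalAt P p).mul (hasFDerivAt_gauss s t p)).congr_fderiv ?_
  ext <;> simp [polyGauss] <;> ring

lemma pdx_polyGauss (s t : ℂ) (P : MvPolynomial (Fin 2) ℂ) :
    pdx (polyGauss s t P) = polyGauss s t (pderiv 0 P - C (s / 2) * X 0 * P) := by
  funext p
  simp [pdx, (hasFDerivAt_polyGauss s t P p).fderiv]

lemma pdy_polyGauss (s t : ℂ) (P : MvPolynomial (Fin 2) ℂ) :
    pdy (polyGauss s t P) = polyGauss s t (pderiv 1 P - C (t / 2) * X 1 * P) := by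
  funext p
  simp [pdy, (hasFDerivAt_polyGauss s t P p).fderiv]

/-! ### Integrals against the Gaussian -/

lemma integrable_pow_mul_cexp (n : ℕ) :
    Integrable fun x : ℝ => (x : ℂ) ^ n * Complex.exp (-(1 / 2) * (x : ℂ) ^ 2) := by
  have h := (integrable_rpow_mul_exp_neg_mul_sq (b := 1 / 2) (by norm_num)
    (s := n) (by linarith [n.cast_nonneg (α := ℝ)])).ofReal (𝕜 := ℂ)
  refine h.congr (.of_forall fun x => ?_)
  simp

lemma gauss_two_two (p : ℝ × ℝ) : gauss 2 2 p = (Real.sqrt (2 * Real.pi) : ℂ)⁻¹ *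
    (Complex.exp (-(1 / 2) * (p.1 : ℂ) ^ 2) * Complex.exp (-(1 / 2) * (p.2 : ℂ) ^ 2)) := by
  rw [gauss, ← Complex.exp_add]
  ring_nf

lemma integrable_polyGauss (P : MvPolynomial (Fin 2) ℂ) : Integrable (polyGauss 2 2 P) := by
  induction P using MvPolynomial.induction_on' with
  | monomial d a =>
    refine (((integrable_pow_mul_cexp (d 0)).mul_prod (integrable_pow_mul_cexp (d 1))).const_mul
      (a * (Real.sqrt (2 * Real.pi) : ℂ)⁻¹)).congr (.of_forall fun p => ?_)
    simp only [polyGauss, gauss_two_two, evalAt, eval_monomial,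
      Finsupp.prod_fintype _ _ (fun _ => pow_zero _), Fin.prod_univ_two, Matrix.cons_val_zero,
      Matrix.cons_val_one]
    ring
  | add P Q hP hQ =>
    refine (hP.add hQ).congr (.of_forall fun p => ?_)
    simp [polyGauss, add_mul]

/-- Integration against the standard Gaussian measure of the plane. -/
noncomputable def gaussIntegral : MvPolynomial (Fin 2) ℂ →ₗ[ℂ] ℂ where
  toFun P := (Real.sqrt (2 * Real.pi) : ℂ)⁻¹ * ∫ p, polyGauss 2 2 P p
  map_add' P Q := by
    rw [← mul_add, ← integral_add (integrable_polyGauss P) (integrable_polyGauss Q)]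
    simp [polyGauss, add_mul]
  map_smul' a P := by
    have h : ∀ p, polyGauss 2 2 (a • P) p = a * polyGauss 2 2 P p := fun p => by
      simp [polyGauss, smul_eq_C_mul, mul_assoc]
    simp only [h, integral_const_mul, RingHom.id_apply, smul_eq_mul]
    ring

lemma integral_fderiv_eq_zero {f : ℝ × ℝ → ℂ} (v : ℝ × ℝ) (hf : Differentiable ℝ f)
    (hfi : Integrable f) (hfi' : Integrable fun p => fderiv ℝ f p v) :
    ∫ p, fderiv ℝ f p v = 0 := by
  simpa using integral_mul_fderiv_eq_neg_fderiv_mul_of_integrable (𝕜 := ℂ)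
    (f := fun _ : ℝ × ℝ => (1 : ℂ)) (g := f) (v := v) (μ := volume) (by simp) (by simpa using hfi')
    (by simpa using hfi) (fun x _ => by fun_prop) (fun x _ => hf x)

/-- Stein's identity. -/
lemma gaussIntegral_X_mul (i : Fin 2) (P : MvPolynomial (Fin 2) ℂ) :
    gaussIntegral (X i * P) = gaussIntegral (pderiv i P) := by
  have hd : Differentiable ℝ (polyGauss 2 2 P) := fun p =>
    (hasFDerivAt_polyGauss 2 2 P p).differentiableAt
  rw [eq_comm, ← sub_eq_zero, ← map_sub]
  refine mul_eq_zero_of_right _ ?_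
  fin_cases i
  · have h := pdx_polyGauss 2 2 P
    rw [div_self two_ne_zero, C_1, one_mul] at h
    change ∫ p, polyGauss 2 2 (pderiv 0 P - X 0 * P) p = 0
    rw [← h]
    refine integral_fderiv_eq_zero (1, 0) hd (integrable_polyGauss P) ?_
    change Integrable (pdx (polyGauss 2 2 P))
    rw [h]
    exact integrable_polyGauss _
  · have h := pdy_polyGauss 2 2 P
    rw [div_self two_ne_zero, C_1, one_mul] at h
    change ∫ p, polyGauss 2 2 (pderiv 1 P - X 1 * P) p = 0
    rw [← h]
    refine integral_fderiv_eq_zero (0, 1) hd (integrable_polyGauss P) ?_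
    change Integrable (pdy (polyGauss 2 2 P))
    rw [h]
    exact integrable_polyGauss _

lemma integral_cexp_neg_half_sq :
    ∫ x : ℝ, Complex.exp (-(1 / 2) * (x : ℂ) ^ 2) = (Real.sqrt (2 * Real.pi) : ℂ) := by
  have h := congrArg ((↑) : ℝ → ℂ) (integral_gaussian (1 / 2))
  rw [← integral_complex_ofReal] at h
  rw [mul_comm 2 Real.pi]
  simpa using h

lemma gaussIntegral_one : gaussIntegral 1 = 1 := by
  have hs : (Real.sqrt (2 * Real.pi) : ℂ) ≠ 0 := by
    exact_mod_cast (Real.sqrt_pos.2 (by positivity)).ne'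
  change (Real.sqrt (2 * Real.pi) : ℂ)⁻¹ * ∫ p, polyGauss 2 2 1 p = 1
  simp only [polyGauss, map_one, one_mul, gauss_two_two, integral_const_mul]
  rw [Measure.volume_eq_prod, integral_prod_mul (fun x : ℝ => Complex.exp (-(1 / 2) * (x : ℂ) ^ 2))
    (fun x : ℝ => Complex.exp (-(1 / 2) * (x : ℂ) ^ 2)), integral_cexp_neg_half_sq]
  field_simp

lemma conj_polyGauss_mul_polyGauss (s t : ℝ) (P Q : MvPolynomial (Fin 2) ℂ) (p : ℝ × ℝ) :
    starRingEnd ℂ (polyGauss s t P p) * polyGauss (2 - s) (2 - t) Q p =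
      (Real.sqrt (2 * Real.pi) : ℂ)⁻¹ * polyGauss 2 2 (conjPoly P * Q) p := by
  have h : Complex.exp (-2 * (p.1 : ℂ) ^ 2 / 4 - 2 * (p.2 : ℂ) ^ 2 / 4) =
      Complex.exp (-s * (p.1 : ℂ) ^ 2 / 4 - t * (p.2 : ℂ) ^ 2 / 4) *
        Complex.exp (-(2 - s) * (p.1 : ℂ) ^ 2 / 4 - (2 - t) * (p.2 : ℂ) ^ 2 / 4) := by
    rw [← Complex.exp_add]
    ring_nf
  simp only [polyGauss, gauss, map_mul, evalAt_conjPoly, h, map_inv₀, Complex.conj_ofReal,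
    ← Complex.exp_conj, map_sub, map_div₀, map_neg, map_pow, map_ofNat]
  ring

/-! ### The operators of the problem on polynomials times Gaussians -/

/-- An operator acting on `polyGauss s t P` through `P` has its iterates act likewise. -/
lemma iterate_polyGauss {s t : ℂ} {T : (ℝ × ℝ → ℂ) → ℝ × ℝ → ℂ}
    {R : MvPolynomial (Fin 2) ℂ → MvPolynomial (Fin 2) ℂ}
    (h : ∀ P, T (polyGauss s t P) = polyGauss s t (R P)) (n : ℕ) (P : MvPolynomial (Fin 2) ℂ) :
    T^[n] (polyGauss s t P) = polyGauss s t (R^[n] P) :=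
  (Function.Semiconj.iterate_right (f := polyGauss s t) (fun P => (h P).symm) n P).symm

lemma Bgll_polyGauss (k₁ k₂ : ℝ) (P : MvPolynomial (Fin 2) ℂ) :
    Bgll k₁ k₂ (polyGauss (1 + 2 * k₂) (1 - 2 * k₁) P) =
      polyGauss (1 + 2 * k₂) (1 - 2 * k₁)
        (raise ((Real.sqrt 2 : ℂ)⁻¹ * Complex.I) (Real.sqrt 2 : ℂ)⁻¹ P) := by
  funext p
  simp only [Bgll, pdx_polyGauss, pdy_polyGauss, polyGauss, raise, map_sub, map_add, map_mul,
    evalAt_C, evalAt_X_zero, evalAt_X_one]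
  ring

lemma B'gll_polyGauss (k₁ k₂ : ℝ) (P : MvPolynomial (Fin 2) ℂ) :
    B'gll k₁ k₂ (polyGauss (1 + 2 * k₂) (1 - 2 * k₁) P) =
      polyGauss (1 + 2 * k₂) (1 - 2 * k₁)
        (raise (Real.sqrt 2 : ℂ)⁻¹ ((Real.sqrt 2 : ℂ)⁻¹ * Complex.I) P) := by
  funext p
  simp only [B'gll, pdx_polyGauss, pdy_polyGauss, polyGauss, raise, map_sub, map_add, map_mul,
    evalAt_C, evalAt_X_zero, evalAt_X_one]
  ring

lemma Adag_eq_Bgll (k₁ k₂ : ℝ) : Adag k₁ k₂ = Bgll (-k₁) (-k₂) := by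
  funext f p
  simp only [Adag, Bgll, Complex.ofReal_neg]
  ring

lemma A'dag_eq_B'gll (k₁ k₂ : ℝ) : A'dag k₁ k₂ = B'gll (-k₁) (-k₂) := by
  funext f p
  simp only [A'dag, B'gll, Complex.ofReal_neg]
  ring

lemma psi00_eq_phi00 (k₁ k₂ : ℝ) : psi00 k₁ k₂ = phi00 (-k₁) (-k₂) := by
  funext p
  simp only [psi00, phi00, Complex.ofReal_neg]
  ring_nf

lemma psiNL_eq_phiNL (k₁ k₂ : ℝ) (n l : ℕ) : psiNL k₁ k₂ n l = phiNL (-k₁) (-k₂) n l := by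
  funext p
  simp only [psiNL, phiNL, Adag_eq_Bgll, A'dag_eq_B'gll, psi00_eq_phi00]

lemma phiNL_eq_polyGauss (k₁ k₂ : ℝ) (n l : ℕ) (p : ℝ × ℝ) :
    phiNL k₁ k₂ n l p = (Real.sqrt (n.factorial * l.factorial) : ℂ)⁻¹ *
      polyGauss (1 + 2 * k₂) (1 - 2 * k₁)
        ((raise (Real.sqrt 2 : ℂ)⁻¹ ((Real.sqrt 2 : ℂ)⁻¹ * Complex.I))^[n]
          ((raise ((Real.sqrt 2 : ℂ)⁻¹ * Complex.I) (Real.sqrt 2 : ℂ)⁻¹)^[l] 1)) p := by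
  have h : phi00 k₁ k₂ = polyGauss (1 + 2 * k₂) (1 - 2 * k₁) 1 := by
    funext p
    simp [phi00, polyGauss, gauss]
  rw [phiNL, h, iterate_polyGauss (Bgll_polyGauss k₁ k₂), iterate_polyGauss (B'gll_polyGauss k₁ k₂)]

lemma inv_sqrt_two_mul_self : (Real.sqrt 2 : ℂ)⁻¹ * (Real.sqrt 2 : ℂ)⁻¹ = 1 / 2 := by
  rw [← mul_inv, ← Complex.ofReal_mul, Real.mul_self_sqrt (by norm_num)]
  norm_num

end BiorthogonalHermite

open BiorthogonalHermite in
theorem statement6 (k₁ k₂ : ℝ)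
    (hk₁ : -1/2 < k₁ ∧ k₁ < 1/2) (hk₂ : -1/2 < k₂ ∧ k₂ < 1/2) :
    ∀ n m l k : ℕ,
      ∫ p : ℝ × ℝ, (starRingEnd ℂ) (psiNL k₁ k₂ n l p) * phiNL k₁ k₂ m k p ∂volume =
        if n = m ∧ l = k then 1 else 0 := by
  intro n m l k
  set P : ℕ → ℕ → MvPolynomial (Fin 2) ℂ := fun n l =>
    (raise (Real.sqrt 2 : ℂ)⁻¹ ((Real.sqrt 2 : ℂ)⁻¹ * Complex.I))^[n]
      ((raise ((Real.sqrt 2 : ℂ)⁻¹ * Complex.I) (Real.sqrt 2 : ℂ)⁻¹)^[l] 1)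
  have hortho : gaussIntegral (conjPoly (P n l) * P m k) =
      if n = m ∧ l = k then (n.factorial * l.factorial : ℂ) else 0 := by
    refine map_conj_iterate_raise_mul _ gaussIntegral_X_mul gaussIntegral_one _ _ _ _ ?_ ?_ ?_
      n m l k <;>
    simp only [map_mul, map_inv₀, Complex.conj_ofReal, Complex.conj_I]
    · linear_combination (1 - Complex.I ^ 2) * inv_sqrt_two_mul_self - Complex.I_sq / 2
    · linear_combination (1 - Complex.I ^ 2) * inv_sqrt_two_mul_self - Complex.I_sq / 2
    · ring
  have hint : ∀ p, (starRingEnd ℂ) (psiNL k₁ k₂ n l p) * phiNL k₁ k₂ m k p =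
      (Real.sqrt (n.factorial * l.factorial) : ℂ)⁻¹ *
        (Real.sqrt (m.factorial * k.factorial) : ℂ)⁻¹ *
        ((Real.sqrt (2 * Real.pi) : ℂ)⁻¹ * polyGauss 2 2 (conjPoly (P n l) * P m k) p) := by
    intro p
    have h := conj_polyGauss_mul_polyGauss (1 - 2 * k₂) (1 + 2 * k₁) (P n l) (P m k) p
    rw [← h, psiNL_eq_phiNL, phiNL_eq_polyGauss, phiNL_eq_polyGauss, map_mul, map_inv₀,
      Complex.conj_ofReal]
    simp only [P]
    push_cast
    ring_nf
  simp only [hint, integral_const_mul]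
  change _ * gaussIntegral (conjPoly (P n l) * P m k) = _
  rw [hortho]
  split_ifs with h
  · obtain ⟨rfl, rfl⟩ := h
    rw [← mul_inv, ← Complex.ofReal_mul, Real.mul_self_sqrt (by positivity)]
    push_cast
    exact inv_mul_cancel₀ (by exact_mod_cast (by positivity))
  · rw [mul_zero]
end

section
/- Fix real k₁, k₂. For every n, l ∈ ℕ the functions φ_{n,l} = (n! l!)^{−1/2} B′ⁿ Bˡ φ₀₀ satisfy the eigenvalue equations (B′A′) φ_{n,l} = n φ_{n,l} and (B A) φ_{n,l} = l φ_{n,l}, identically on ℝ². Equivalently, h′ φ_{n,l} = (n − 1/2) φ_{n,l} and h φ_{n,l} = (l − 1/2) φ_{n,l}, where h′ = B′A′ − (1/2)·id and h = B A − (1/2)·id. -/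
open MeasureTheory

/-- `A f = (1/√2)(−i ∂ₓ f + ∂_y f + (−(i x/2)(1+2k₂) + (y/2)(1−2k₁)) f)`. -/
noncomputable def Agll (k₁ k₂ : ℝ) (f : ℝ × ℝ → ℂ) : ℝ × ℝ → ℂ := fun p =>
  (Real.sqrt 2 : ℂ)⁻¹ * (-Complex.I * pdx f p + pdy f p +
    (-(Complex.I * (p.1 : ℂ) / 2) * (1 + 2 * (k₂ : ℂ)) +
      ((p.2 : ℂ) / 2) * (1 - 2 * (k₁ : ℂ))) * f p)

/-- `A′ f = (1/√2)(∂ₓ f − i ∂_y f + ((x/2)(1+2k₂) − (i y/2)(1−2k₁)) f)`. -/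
noncomputable def A'gll (k₁ k₂ : ℝ) (f : ℝ × ℝ → ℂ) : ℝ × ℝ → ℂ := fun p =>
  (Real.sqrt 2 : ℂ)⁻¹ * (pdx f p - Complex.I * pdy f p +
    (((p.1 : ℂ) / 2) * (1 + 2 * (k₂ : ℂ)) -
      (Complex.I * (p.2 : ℂ) / 2) * (1 - 2 * (k₁ : ℂ))) * f p)

open scoped ContDiff

/-- The first-order operator `f ↦ a ∂ₓ f + b ∂_y f + (c x + d y) f`. -/
noncomputable def linOp (a b c d : ℂ) (f : ℝ × ℝ → ℂ) : ℝ × ℝ → ℂ := fun p =>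
  a * pdx f p + b * pdy f p + (c * (p.1 : ℂ) + d * (p.2 : ℂ)) * f p

lemma contDiff_ofReal_fst : ContDiff ℝ ∞ fun p : ℝ × ℝ => (p.1 : ℂ) :=
  Complex.ofRealCLM.contDiff.comp contDiff_fst

lemma contDiff_ofReal_snd : ContDiff ℝ ∞ fun p : ℝ × ℝ => (p.2 : ℂ) :=
  Complex.ofRealCLM.contDiff.comp contDiff_snd

lemma contDiff_pdx {f : ℝ × ℝ → ℂ} (hf : ContDiff ℝ ∞ f) : ContDiff ℝ ∞ (pdx f) :=
  (hf.fderiv_right (m := ∞) (by simp)).clm_apply contDiff_const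

lemma contDiff_pdy {f : ℝ × ℝ → ℂ} (hf : ContDiff ℝ ∞ f) : ContDiff ℝ ∞ (pdy f) :=
  (hf.fderiv_right (m := ∞) (by simp)).clm_apply contDiff_const

lemma contDiff_linOp (a b c d : ℂ) {f : ℝ × ℝ → ℂ} (hf : ContDiff ℝ ∞ f) :
    ContDiff ℝ ∞ (linOp a b c d f) :=
  ((contDiff_const.mul (contDiff_pdx hf)).add (contDiff_const.mul (contDiff_pdy hf))).add
    (((contDiff_const.mul contDiff_ofReal_fst).add
      (contDiff_const.mul contDiff_ofReal_snd)).mul hf)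

lemma linOp_const_mul (a b c d μ : ℂ) (f : ℝ × ℝ → ℂ) :
    linOp a b c d (fun p => μ * f p) = fun p => μ * linOp a b c d f p := by
  have h (p : ℝ × ℝ) : fderiv ℝ (fun q => μ * f q) p = μ • fderiv ℝ f p :=
    congrFun (fderiv_const_smul_field (𝕜 := ℝ) (f := f) μ) p
  funext p
  simp only [linOp, pdx, pdy, h, smul_apply, smul_eq_mul]
  ring

lemma linOp_add (a b c d : ℂ) {f g : ℝ × ℝ → ℂ} (hf : ContDiff ℝ ∞ f) (hg : ContDiff ℝ ∞ g) :
    linOp a b c d (fun p => f p + g p) = fun p => linOp a b c d f p + linOp a b c d g p := by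
  funext p
  have h : fderiv ℝ (fun q => f q + g q) p = fderiv ℝ f p + fderiv ℝ g p :=
    fderiv_fun_add (hf.differentiable (by simp) p) (hg.differentiable (by simp) p)
  simp only [linOp, pdx, pdy, h, add_apply]
  ring

lemma fderiv_linOp_apply (a b c d : ℂ) {f : ℝ × ℝ → ℂ} (hf : ContDiff ℝ ∞ f) (p v : ℝ × ℝ) :
    fderiv ℝ (linOp a b c d f) p v =
      a * fderiv ℝ (pdx f) p v + b * fderiv ℝ (pdy f) p v +
        (c * (v.1 : ℂ) + d * (v.2 : ℂ)) * f p +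
        (c * (p.1 : ℂ) + d * (p.2 : ℂ)) * fderiv ℝ f p v := by
  have hx := ((contDiff_pdx hf).differentiable (by simp) p).hasFDerivAt
  have hy := ((contDiff_pdy hf).differentiable (by simp) p).hasFDerivAt
  have h₀ := (hf.differentiable (by simp) p).hasFDerivAt
  have h₁ : HasFDerivAt (fun q : ℝ × ℝ => (q.1 : ℂ))
      (Complex.ofRealCLM.comp (ContinuousLinearMap.fst ℝ ℝ ℝ)) p :=
    (Complex.ofRealCLM.comp (ContinuousLinearMap.fst ℝ ℝ ℝ)).hasFDerivAt
  have h₂ : HasFDerivAt (fun q : ℝ × ℝ => (q.2 : ℂ))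
      (Complex.ofRealCLM.comp (ContinuousLinearMap.snd ℝ ℝ ℝ)) p :=
    (Complex.ofRealCLM.comp (ContinuousLinearMap.snd ℝ ℝ ℝ)).hasFDerivAt
  have h := ((hx.const_mul a).add (hy.const_mul b)).add
    (((h₁.const_mul c).add (h₂.const_mul d)).mul h₀)
  rw [show fderiv ℝ (linOp a b c d f) p = _ from h.fderiv]
  simp
  ring

lemma pdx_pdy_comm {f : ℝ × ℝ → ℂ} (hf : ContDiff ℝ ∞ f) (p : ℝ × ℝ) :
    fderiv ℝ (pdy f) p (1, 0) = fderiv ℝ (pdx f) p (0, 1) := by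
  have hd : DifferentiableAt ℝ (fderiv ℝ f) p :=
    (hf.fderiv_right (m := ∞) (by simp)).differentiable (by simp) p
  have h (v w : ℝ × ℝ) : fderiv ℝ (fun q => fderiv ℝ f q v) p w =
      fderiv ℝ (fderiv ℝ f) p w v := by
    rw [fderiv_clm_apply hd (differentiableAt_const v)]
    simp
  unfold pdx pdy
  rw [h, h]
  have hn : minSmoothness ℝ 2 ≤ ∞ := by
    rw [minSmoothness_of_isRCLikeNormedField]
    exact WithTop.coe_le_coe.2 (le_top : (2 : ℕ∞) ≤ ⊤)
  exact (hf.contDiffAt.isSymmSndFDerivAt hn).eq _ _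

/-- The commutator of two operators `linOp` is multiplication by a constant. -/
lemma linOp_linOp (a b c d a₁ b₁ c₁ d₁ : ℂ) {f : ℝ × ℝ → ℂ} (hf : ContDiff ℝ ∞ f) :
    linOp a b c d (linOp a₁ b₁ c₁ d₁ f) = fun p =>
      linOp a₁ b₁ c₁ d₁ (linOp a b c d f) p +
        (a * c₁ + b * d₁ - a₁ * c - b₁ * d) * f p := by
  funext p
  rw [linOp, linOp.eq_def a₁ b₁ c₁ d₁ (linOp a b c d f)]
  simp only [pdx.eq_def (linOp _ _ _ _ _), pdy.eq_def (linOp _ _ _ _ _),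
    fderiv_linOp_apply _ _ _ _ hf, pdx_pdy_comm hf]
  simp only [linOp, pdx, pdy, Complex.ofReal_one, Complex.ofReal_zero]
  ring

/-- If `K` commutes with `M` and `[L, K] = κ`, then applying `K` to an eigenfunction `g` of `M L`
gives `M L K g = μ K g + κ M g`. -/
lemma linOp_ladder {a b c d a₁ b₁ c₁ d₁ a₂ b₂ c₂ d₂ κ μ : ℂ} {g : ℝ × ℝ → ℂ}
    (hg : ContDiff ℝ ∞ g)
    (hLK : a * c₂ + b * d₂ - a₂ * c - b₂ * d = κ)
    (hMK : a₁ * c₂ + b₁ * d₂ - a₂ * c₁ - b₂ * d₁ = 0)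
    (h : linOp a₁ b₁ c₁ d₁ (linOp a b c d g) = fun p => μ * g p) :
    linOp a₁ b₁ c₁ d₁ (linOp a b c d (linOp a₂ b₂ c₂ d₂ g)) = fun p =>
      μ * linOp a₂ b₂ c₂ d₂ g p + κ * linOp a₁ b₁ c₁ d₁ g p := by
  have hL := contDiff_linOp a b c d hg
  rw [linOp_linOp a b c d _ _ _ _ hg, hLK,
    linOp_add _ _ _ _ (contDiff_linOp _ _ _ _ hL) (contDiff_const.mul hg),
    linOp_linOp a₁ b₁ c₁ d₁ _ _ _ _ hL, hMK, h, linOp_const_mul, linOp_const_mul]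
  simp

lemma Agll_eq_linOp (k₁ k₂ : ℝ) : Agll k₁ k₂ =
    linOp ((Real.sqrt 2 : ℂ)⁻¹ * -Complex.I) (Real.sqrt 2 : ℂ)⁻¹
      ((Real.sqrt 2 : ℂ)⁻¹ * (-(Complex.I / 2) * (1 + 2 * k₂)))
      ((Real.sqrt 2 : ℂ)⁻¹ * ((1 - 2 * k₁) / 2)) := by
  funext f p
  simp only [Agll, linOp]
  ring

lemma A'gll_eq_linOp (k₁ k₂ : ℝ) : A'gll k₁ k₂ =
    linOp (Real.sqrt 2 : ℂ)⁻¹ ((Real.sqrt 2 : ℂ)⁻¹ * -Complex.I)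
      ((Real.sqrt 2 : ℂ)⁻¹ * ((1 + 2 * k₂) / 2))
      ((Real.sqrt 2 : ℂ)⁻¹ * (-(Complex.I / 2) * (1 - 2 * k₁))) := by
  funext f p
  simp only [A'gll, linOp]
  ring

lemma Bgll_eq_linOp (k₁ k₂ : ℝ) : Bgll k₁ k₂ =
    linOp ((Real.sqrt 2 : ℂ)⁻¹ * -Complex.I) (-(Real.sqrt 2 : ℂ)⁻¹)
      ((Real.sqrt 2 : ℂ)⁻¹ * (Complex.I / 2 * (1 - 2 * k₂)))
      ((Real.sqrt 2 : ℂ)⁻¹ * ((1 + 2 * k₁) / 2)) := by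
  funext f p
  simp only [Bgll, linOp]
  ring

lemma B'gll_eq_linOp (k₁ k₂ : ℝ) : B'gll k₁ k₂ =
    linOp (-(Real.sqrt 2 : ℂ)⁻¹) ((Real.sqrt 2 : ℂ)⁻¹ * -Complex.I)
      ((Real.sqrt 2 : ℂ)⁻¹ * ((1 - 2 * k₂) / 2))
      ((Real.sqrt 2 : ℂ)⁻¹ * (Complex.I / 2 * (1 + 2 * k₁))) := by
  funext f p
  simp only [B'gll, linOp]
  ring

lemma inv_sqrt_two_sq : ((Real.sqrt 2 : ℂ)⁻¹) ^ 2 = 1 / 2 := by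
  rw [inv_pow, ← Complex.ofReal_pow, Real.sq_sqrt (by norm_num)]
  norm_num

section Ladder

variable {k₁ k₂ : ℝ} {μ : ℂ} {g : ℝ × ℝ → ℂ}

lemma contDiff_Bgll (hg : ContDiff ℝ ∞ g) : ContDiff ℝ ∞ (Bgll k₁ k₂ g) := by
  rw [Bgll_eq_linOp]
  exact contDiff_linOp _ _ _ _ hg

lemma contDiff_B'gll (hg : ContDiff ℝ ∞ g) : ContDiff ℝ ∞ (B'gll k₁ k₂ g) := by
  rw [B'gll_eq_linOp]
  exact contDiff_linOp _ _ _ _ hg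

lemma Bgll_Agll_Bgll (hg : ContDiff ℝ ∞ g)
    (h : Bgll k₁ k₂ (Agll k₁ k₂ g) = fun p => μ * g p) :
    Bgll k₁ k₂ (Agll k₁ k₂ (Bgll k₁ k₂ g)) = fun p => (μ + 1) * Bgll k₁ k₂ g p := by
  rw [Agll_eq_linOp, Bgll_eq_linOp] at *
  rw [linOp_ladder (κ := 1) hg
    (by linear_combination (1 - Complex.I ^ 2) * inv_sqrt_two_sq - Complex.I_sq / 2) (by ring) h]
  simp only [add_mul]

lemma Bgll_Agll_B'gll (hg : ContDiff ℝ ∞ g)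
    (h : Bgll k₁ k₂ (Agll k₁ k₂ g) = fun p => μ * g p) :
    Bgll k₁ k₂ (Agll k₁ k₂ (B'gll k₁ k₂ g)) = fun p => μ * B'gll k₁ k₂ g p := by
  rw [Agll_eq_linOp, Bgll_eq_linOp] at *
  rw [B'gll_eq_linOp, linOp_ladder (κ := 0) hg (by ring) (by ring) h]
  simp

lemma B'gll_A'gll_B'gll (hg : ContDiff ℝ ∞ g)
    (h : B'gll k₁ k₂ (A'gll k₁ k₂ g) = fun p => μ * g p) :
    B'gll k₁ k₂ (A'gll k₁ k₂ (B'gll k₁ k₂ g)) = fun p => (μ + 1) * B'gll k₁ k₂ g p := by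
  rw [A'gll_eq_linOp, B'gll_eq_linOp] at *
  rw [linOp_ladder (κ := 1) hg
    (by linear_combination (1 - Complex.I ^ 2) * inv_sqrt_two_sq - Complex.I_sq / 2) (by ring) h]
  simp only [add_mul]

lemma B'gll_A'gll_Bgll (hg : ContDiff ℝ ∞ g)
    (h : B'gll k₁ k₂ (A'gll k₁ k₂ g) = fun p => μ * g p) :
    B'gll k₁ k₂ (A'gll k₁ k₂ (Bgll k₁ k₂ g)) = fun p => μ * Bgll k₁ k₂ g p := by
  rw [A'gll_eq_linOp, B'gll_eq_linOp] at *
  rw [Bgll_eq_linOp, linOp_ladder (κ := 0) hg (by ring) (by ring) h]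
  simp

end Ladder

lemma hasFDerivAt_phi00 (k₁ k₂ : ℝ) (p : ℝ × ℝ) :
    HasFDerivAt (phi00 k₁ k₂) (phi00 k₁ k₂ p •
      ((-(1 + 2 * (k₂ : ℂ)) * p.1 / 2) •
        Complex.ofRealCLM.comp (ContinuousLinearMap.fst ℝ ℝ ℝ) +
      (-(1 - 2 * (k₁ : ℂ)) * p.2 / 2) •
        Complex.ofRealCLM.comp (ContinuousLinearMap.snd ℝ ℝ ℝ))) p := by
  have h₁ : HasFDerivAt (fun q : ℝ × ℝ => (q.1 : ℂ))
      (Complex.ofRealCLM.comp (ContinuousLinearMap.fst ℝ ℝ ℝ)) p :=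
    (Complex.ofRealCLM.comp (ContinuousLinearMap.fst ℝ ℝ ℝ)).hasFDerivAt
  have h₂ : HasFDerivAt (fun q : ℝ × ℝ => (q.2 : ℂ))
      (Complex.ofRealCLM.comp (ContinuousLinearMap.snd ℝ ℝ ℝ)) p :=
    (Complex.ofRealCLM.comp (ContinuousLinearMap.snd ℝ ℝ ℝ)).hasFDerivAt
  have h := ((((h₁.pow 2).const_mul (-(1 + 2 * (k₂ : ℂ)))).mul_const (4 : ℂ)⁻¹).sub
    (((h₂.pow 2).const_mul (1 - 2 * (k₁ : ℂ))).mul_const (4 : ℂ)⁻¹)).cexp.const_mul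
      (Real.sqrt (2 * Real.pi) : ℂ)⁻¹
  refine h.congr_fderiv ?_
  ext <;> simp [phi00, div_eq_mul_inv] <;> ring

lemma contDiff_phi00 (k₁ k₂ : ℝ) : ContDiff ℝ ∞ (phi00 k₁ k₂) :=
  contDiff_const.mul ((((contDiff_const.mul (contDiff_ofReal_fst.pow 2)).div_const 4).sub
    ((contDiff_const.mul (contDiff_ofReal_snd.pow 2)).div_const 4)).cexp)

lemma Agll_phi00 (k₁ k₂ : ℝ) : Agll k₁ k₂ (phi00 k₁ k₂) = fun _ => 0 := by
  funext p
  simp [Agll, pdx, pdy, (hasFDerivAt_phi00 k₁ k₂ p).fderiv]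
  ring

lemma A'gll_phi00 (k₁ k₂ : ℝ) : A'gll k₁ k₂ (phi00 k₁ k₂) = fun _ => 0 := by
  funext p
  simp [A'gll, pdx, pdy, (hasFDerivAt_phi00 k₁ k₂ p).fderiv]
  ring

lemma iterate_Bgll_phi00_eigen (k₁ k₂ : ℝ) (l : ℕ) :
    ContDiff ℝ ∞ ((Bgll k₁ k₂)^[l] (phi00 k₁ k₂)) ∧
    (B'gll k₁ k₂ (A'gll k₁ k₂ ((Bgll k₁ k₂)^[l] (phi00 k₁ k₂))) =
      fun p => 0 * (Bgll k₁ k₂)^[l] (phi00 k₁ k₂) p) ∧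
    (Bgll k₁ k₂ (Agll k₁ k₂ ((Bgll k₁ k₂)^[l] (phi00 k₁ k₂))) =
      fun p => (l : ℂ) * (Bgll k₁ k₂)^[l] (phi00 k₁ k₂) p) := by
  induction l with
  | zero =>
    refine ⟨contDiff_phi00 k₁ k₂, ?_, ?_⟩
    · funext p
      simp [A'gll_phi00, B'gll, pdx, pdy]
    · funext p
      simp [Agll_phi00, Bgll, pdx, pdy]
  | succ l ih =>
    obtain ⟨hs, h', h⟩ := ih
    rw [Function.iterate_succ_apply', Nat.cast_succ]
    exact ⟨contDiff_Bgll hs, B'gll_A'gll_Bgll hs h', Bgll_Agll_Bgll hs h⟩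

lemma iterate_B'gll_eigen (k₁ k₂ : ℝ) (n l : ℕ) :
    ContDiff ℝ ∞ ((B'gll k₁ k₂)^[n] ((Bgll k₁ k₂)^[l] (phi00 k₁ k₂))) ∧
    (B'gll k₁ k₂ (A'gll k₁ k₂ ((B'gll k₁ k₂)^[n] ((Bgll k₁ k₂)^[l] (phi00 k₁ k₂)))) =
      fun p => (n : ℂ) * (B'gll k₁ k₂)^[n] ((Bgll k₁ k₂)^[l] (phi00 k₁ k₂)) p) ∧
    (Bgll k₁ k₂ (Agll k₁ k₂ ((B'gll k₁ k₂)^[n] ((Bgll k₁ k₂)^[l] (phi00 k₁ k₂)))) =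
      fun p => (l : ℂ) * (B'gll k₁ k₂)^[n] ((Bgll k₁ k₂)^[l] (phi00 k₁ k₂)) p) := by
  induction n with
  | zero => simpa using iterate_Bgll_phi00_eigen k₁ k₂ l
  | succ n ih =>
    obtain ⟨hs, h', h⟩ := ih
    rw [Function.iterate_succ_apply', Nat.cast_succ]
    exact ⟨contDiff_B'gll hs, B'gll_A'gll_B'gll hs h', Bgll_Agll_B'gll hs h⟩

theorem statement7 (k₁ k₂ : ℝ) (n l : ℕ) :
    (B'gll k₁ k₂ (A'gll k₁ k₂ (phiNL k₁ k₂ n l)) =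
      fun p => (n : ℂ) * phiNL k₁ k₂ n l p) ∧
    (Bgll k₁ k₂ (Agll k₁ k₂ (phiNL k₁ k₂ n l)) =
      fun p => (l : ℂ) * phiNL k₁ k₂ n l p) ∧
    ((fun p => B'gll k₁ k₂ (A'gll k₁ k₂ (phiNL k₁ k₂ n l)) p -
        (1 / 2 : ℂ) * phiNL k₁ k₂ n l p) =
      fun p => ((n : ℂ) - 1 / 2) * phiNL k₁ k₂ n l p) ∧
    ((fun p => Bgll k₁ k₂ (Agll k₁ k₂ (phiNL k₁ k₂ n l)) p -
        (1 / 2 : ℂ) * phiNL k₁ k₂ n l p) =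
      fun p => ((l : ℂ) - 1 / 2) * phiNL k₁ k₂ n l p) := by
  obtain ⟨-, h', h⟩ := iterate_B'gll_eigen k₁ k₂ n l
  have e' : B'gll k₁ k₂ (A'gll k₁ k₂ (phiNL k₁ k₂ n l)) =
      fun p => (n : ℂ) * phiNL k₁ k₂ n l p := by
    rw [A'gll_eq_linOp, B'gll_eq_linOp] at *
    unfold phiNL
    rw [B'gll_eq_linOp, linOp_const_mul, linOp_const_mul, h']
    funext p
    ring
  have e : Bgll k₁ k₂ (Agll k₁ k₂ (phiNL k₁ k₂ n l)) =
      fun p => (l : ℂ) * phiNL k₁ k₂ n l p := by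
    rw [Agll_eq_linOp, Bgll_eq_linOp] at *
    unfold phiNL
    rw [Bgll_eq_linOp, linOp_const_mul, linOp_const_mul, h]
    funext p
    ring
  refine ⟨e', e, ?_, ?_⟩
  · rw [e']
    funext p
    ring
  · rw [e]
    funext p
    ring
end

section
/- Fix real k₁, k₂ with −1/2 < k₁ < 1/2, −1/2 < k₂ < 1/2 and (k₁,k₂) ≠ (0,0). Then the family {φ_{n,l} : n, l ∈ ℕ} is not a Riesz basis of L²(ℝ²; ℂ): there exist no orthonormal basis {e_{n,l}}_{n,l ∈ ℕ} of L²(ℝ²; ℂ) and no continuous linear bijection V : L²(ℝ²; ℂ) → L²(ℝ²; ℂ) with continuous inverse such that φ_{n,l} = V e_{n,l} for all n, l ∈ ℕ. -/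
open MeasureTheory

open scoped ENNReal

theorem B'gll_pow_mul_phi00 (k₁ k₂ : ℝ) (n : ℕ) :
    B'gll k₁ k₂ (fun p => (((p.1 : ℂ) + Complex.I * p.2) * (Real.sqrt 2 : ℂ)⁻¹) ^ n
      * phi00 k₁ k₂ p) =
    fun p => (((p.1 : ℂ) + Complex.I * p.2) * (Real.sqrt 2 : ℂ)⁻¹) ^ (n + 1) * phi00 k₁ k₂ p := by
  funext p
  have hx : HasFDerivAt (fun q : ℝ × ℝ => (q.1 : ℂ))
      (Complex.ofRealCLM ∘L ContinuousLinearMap.fst ℝ ℝ ℝ) p :=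
    (Complex.ofRealCLM ∘L ContinuousLinearMap.fst ℝ ℝ ℝ).hasFDerivAt
  have hy : HasFDerivAt (fun q : ℝ × ℝ => (q.2 : ℂ))
      (Complex.ofRealCLM ∘L ContinuousLinearMap.snd ℝ ℝ ℝ) p :=
    (Complex.ofRealCLM ∘L ContinuousLinearMap.snd ℝ ℝ ℝ).hasFDerivAt
  have hz := ((hx.add (hy.const_mul Complex.I)).mul_const (Real.sqrt 2 : ℂ)⁻¹).pow n
  have hg := ((((hx.pow 2).const_mul (-(1 + 2 * (k₂ : ℂ)))).mul_const (4 : ℂ)⁻¹).sub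
    (((hy.pow 2).const_mul (1 - 2 * (k₁ : ℂ))).mul_const (4 : ℂ)⁻¹)).cexp.const_mul
      (Real.sqrt (2 * Real.pi) : ℂ)⁻¹
  have h := (hz.mul hg).fderiv
  unfold B'gll pdx pdy
  simp only [phi00, div_eq_mul_inv] at h ⊢
  erw [h]
  simp
  generalize Complex.exp _ = E
  generalize (Real.sqrt 2 : ℂ)⁻¹ = s
  ring_nf
  simp only [Complex.I_sq]
  ring

theorem iterate_B'gll_phi00 (k₁ k₂ : ℝ) (n : ℕ) :
    (B'gll k₁ k₂)^[n] (phi00 k₁ k₂) =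
    fun p => (((p.1 : ℂ) + Complex.I * p.2) * (Real.sqrt 2 : ℂ)⁻¹) ^ n * phi00 k₁ k₂ p := by
  induction n with
  | zero => simp
  | succ n ih => rw [Function.iterate_succ_apply', ih, B'gll_pow_mul_phi00]

theorem enorm_phiNL_zero_sq (k₁ k₂ : ℝ) (n : ℕ) (p : ℝ × ℝ) :
    ‖phiNL k₁ k₂ n 0 p‖ₑ ^ 2 = ENNReal.ofReal ((2 * Real.pi)⁻¹ *
      (((p.1 ^ 2 + p.2 ^ 2) / 2) ^ n / n.factorial) *
      Real.exp (-((1 + 2 * k₂) / 2 * p.1 ^ 2) - (1 - 2 * k₁) / 2 * p.2 ^ 2)) := by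
  rw [← ofReal_norm, ← ENNReal.ofReal_pow (norm_nonneg _)]
  congr 1
  have hz : ‖(p.1 : ℂ) + Complex.I * p.2‖ ^ 2 = p.1 ^ 2 + p.2 ^ 2 := by
    rw [mul_comm, Complex.sq_norm, Complex.normSq_add_mul_I]
  have hE : ‖Complex.exp (-(1 + 2 * (k₂ : ℂ)) * (p.1 : ℂ) ^ 2 / 4 -
      (1 - 2 * (k₁ : ℂ)) * (p.2 : ℂ) ^ 2 / 4)‖ ^ 2 =
      Real.exp (-((1 + 2 * k₂) / 2 * p.1 ^ 2) - (1 - 2 * k₁) / 2 * p.2 ^ 2) := by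
    have : (-(1 + 2 * (k₂ : ℂ)) * (p.1 : ℂ) ^ 2 / 4 - (1 - 2 * (k₁ : ℂ)) * (p.2 : ℂ) ^ 2 / 4) =
        ((-(1 + 2 * k₂) * p.1 ^ 2 / 4 - (1 - 2 * k₁) * p.2 ^ 2 / 4 : ℝ) : ℂ) := by
      push_cast; ring
    rw [this, Complex.norm_exp_ofReal, ← Real.exp_nat_mul]
    congr 1
    push_cast; ring
  have hπ : 0 ≤ 2 * Real.pi := by positivity
  simp only [phiNL, Function.iterate_zero, id, iterate_B'gll_phi00, phi00, norm_mul, norm_inv,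
    norm_pow, mul_pow, inv_pow, hE, Complex.norm_real, Real.norm_eq_abs, sq_abs,
    Real.sq_sqrt hπ, Nat.factorial_zero, Nat.cast_one, mul_one]
  rw [Real.sq_sqrt (by positivity), ← pow_mul, ← pow_mul, mul_comm n 2, pow_mul, pow_mul, hz,
    sq_abs, Real.sq_sqrt (by norm_num), div_pow]
  field_simp

theorem lintegral_exp_neg_mul_sq {s : ℝ} (hs : 0 < s) :
    ∫⁻ x : ℝ, ENNReal.ofReal (Real.exp (-(s * x ^ 2))) = ENNReal.ofReal (Real.sqrt (Real.pi / s)) := by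
  rw [← integral_gaussian s, ofReal_integral_eq_lintegral_ofReal (integrable_exp_neg_mul_sq hs)
    (Filter.Eventually.of_forall fun x => (Real.exp_pos _).le)]
  simp only [neg_mul]

theorem lintegral_exp_neg_mul_sq_ne_zero (s : ℝ) :
    ∫⁻ x : ℝ, ENNReal.ofReal (Real.exp (-(s * x ^ 2))) ≠ 0 := by
  rw [Ne, lintegral_eq_zero_iff (by fun_prop)]
  intro h
  obtain ⟨x, hx⟩ := h.exists
  have : 0 < ENNReal.ofReal (Real.exp (-(s * x ^ 2))) := ENNReal.ofReal_pos.2 (Real.exp_pos _)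
  exact this.ne' hx

/-- The generating function of the squared norms of `φ_{n,0}`, as a product of Gaussian integrals. -/
theorem tsum_pow_mul_lintegral_phiNL_zero (k₁ k₂ : ℝ) {t : ℝ} (ht : 0 ≤ t) :
    ∑' n : ℕ, ENNReal.ofReal t ^ n * ∫⁻ p, ‖phiNL k₁ k₂ n 0 p‖ₑ ^ 2 =
    ENNReal.ofReal (2 * Real.pi)⁻¹ *
      ((∫⁻ x : ℝ, ENNReal.ofReal (Real.exp (-(((1 + 2 * k₂) - t) / 2 * x ^ 2)))) *
        ∫⁻ y : ℝ, ENNReal.ofReal (Real.exp (-(((1 - 2 * k₁) - t) / 2 * y ^ 2)))) := by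
  have hsum (p : ℝ × ℝ) : ∑' n : ℕ, ENNReal.ofReal t ^ n * ‖phiNL k₁ k₂ n 0 p‖ₑ ^ 2 =
      ENNReal.ofReal (2 * Real.pi)⁻¹ *
        (ENNReal.ofReal (Real.exp (-(((1 + 2 * k₂) - t) / 2 * p.1 ^ 2))) *
          ENNReal.ofReal (Real.exp (-(((1 - 2 * k₁) - t) / 2 * p.2 ^ 2)))) := by
    have hexp := ((NormedSpace.expSeries_div_hasSum_exp (𝔸 := ℝ)
      (t * ((p.1 ^ 2 + p.2 ^ 2) / 2))).mul_left (2 * Real.pi)⁻¹).mul_right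
      (Real.exp (-((1 + 2 * k₂) / 2 * p.1 ^ 2) - (1 - 2 * k₁) / 2 * p.2 ^ 2))
    rw [← Real.exp_eq_exp_ℝ, mul_assoc, ← Real.exp_add] at hexp
    rw [← ENNReal.ofReal_mul (Real.exp_pos _).le, ← ENNReal.ofReal_mul (by positivity),
      ← Real.exp_add]
    convert (ENNReal.ofReal_tsum_of_nonneg (fun n => by positivity) hexp.summable).symm using 1
    · congr 1
      funext n
      rw [enorm_phiNL_zero_sq, ← ENNReal.ofReal_pow ht, ← ENNReal.ofReal_mul (by positivity)]
      congr 1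
      rw [mul_pow]
      ring
    · rw [hexp.tsum_eq]
      congr 3
      ring
  have hmeas (n : ℕ) : Measurable fun p => ‖phiNL k₁ k₂ n 0 p‖ₑ ^ 2 := by
    simp only [enorm_phiNL_zero_sq]
    fun_prop
  rw [← lintegral_prod_mul (by fun_prop) (by fun_prop), ← Measure.volume_eq_prod,
    ← lintegral_const_mul _ (by fun_prop)]
  simp only [← hsum]
  rw [lintegral_tsum fun n => ((hmeas n).const_mul _).aemeasurable]
  simp only [lintegral_const_mul _ (hmeas _)]

theorem lintegral_enorm_sq_eq_enorm_sq {α : Type*} [MeasurableSpace α] {μ : Measure α}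
    (f : Lp ℂ 2 μ) : ∫⁻ p, ‖f p‖ₑ ^ 2 ∂μ = ‖f‖ₑ ^ 2 := by
  rw [Lp.enorm_def, eLpNorm_eq_lintegral_rpow_enorm_toReal (by norm_num) (by norm_num)]
  rw [← ENNReal.rpow_natCast, ← ENNReal.rpow_mul]
  simp

/-- The squared norms of `φ_{n,0}` are not bounded away from both `0` and `∞`. -/
theorem not_bounded_lintegral_phiNL_zero {k₁ k₂ : ℝ}
    (hk₁ : -1/2 < k₁ ∧ k₁ < 1/2) (hk₂ : -1/2 < k₂ ∧ k₂ < 1/2)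
    (hne : (k₁, k₂) ≠ (0, 0)) {c C : ℝ} (hc : 0 < c)
    (hlow : ∀ n, ENNReal.ofReal c ≤ ∫⁻ p, ‖phiNL k₁ k₂ n 0 p‖ₑ ^ 2)
    (hupp : ∀ n, ∫⁻ p, ‖phiNL k₁ k₂ n 0 p‖ₑ ^ 2 ≤ ENNReal.ofReal C) : False := by
  have hgeom {t : ℝ} (ht : 0 ≤ t) (ht1 : t < 1) (D : ℝ) :
      ∑' n : ℕ, ENNReal.ofReal t ^ n * ENNReal.ofReal D =
        ENNReal.ofReal (1 - t)⁻¹ * ENNReal.ofReal D := by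
    rw [ENNReal.tsum_mul_right, ENNReal.tsum_geometric, ENNReal.ofReal_inv_of_pos (by linarith),
      ENNReal.ofReal_sub _ ht, ENNReal.ofReal_one]
  have hfin {t : ℝ} (ht : 0 ≤ t) (ht1 : t < 1) :
      ENNReal.ofReal (2 * Real.pi)⁻¹ *
      ((∫⁻ x : ℝ, ENNReal.ofReal (Real.exp (-(((1 + 2 * k₂) - t) / 2 * x ^ 2)))) *
        ∫⁻ y : ℝ, ENNReal.ofReal (Real.exp (-(((1 - 2 * k₁) - t) / 2 * y ^ 2)))) ≠ ∞ := by
    rw [← tsum_pow_mul_lintegral_phiNL_zero k₁ k₂ ht]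
    refine ne_top_of_le_ne_top ?_ (ENNReal.tsum_le_tsum fun n => mul_le_mul_right (hupp n) _)
    rw [hgeom ht ht1]
    exact ENNReal.mul_ne_top ENNReal.ofReal_ne_top ENNReal.ofReal_ne_top
  have hpi : ENNReal.ofReal (2 * Real.pi)⁻¹ ≠ 0 := by
    rw [Ne, ENNReal.ofReal_eq_zero, not_le]; positivity
  have h₂ : 0 ≤ k₂ := by
    by_contra! h
    apply hfin (t := 1 + 2 * k₂) (by linarith) (by linarith)
    simp only [sub_self, zero_div, zero_mul, neg_zero, Real.exp_zero, ENNReal.ofReal_one,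
      lintegral_one, Real.volume_univ, ENNReal.top_mul (lintegral_exp_neg_mul_sq_ne_zero _),
      ENNReal.mul_top hpi]
  have h₁ : k₁ ≤ 0 := by
    by_contra! h
    apply hfin (t := 1 - 2 * k₁) (by linarith) (by linarith)
    simp only [sub_self, zero_div, zero_mul, neg_zero, Real.exp_zero, ENNReal.ofReal_one,
      lintegral_one, Real.volume_univ, ENNReal.mul_top (lintegral_exp_neg_mul_sq_ne_zero _),
      ENNReal.mul_top hpi]
  have hd : 0 < k₂ - k₁ := by
    rcases h₂.lt_or_eq with h | h
    · linarith
    · rcases h₁.lt_or_eq with h' | h'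
      · linarith
      · exact absurd (by rw [h', h]) hne
  have key {s : ℝ} (hs : 0 < s) (hs1 : s ≤ 1) : c ^ 2 * ((2 * k₂ + s) * (-2 * k₁ + s)) ≤ s ^ 2 := by
    have h := ENNReal.tsum_le_tsum fun n =>
      mul_le_mul_right (hlow n) (ENNReal.ofReal (1 - s) ^ n)
    have ha : 0 < 2 * k₂ + s := by linarith
    have hb : 0 < -2 * k₁ + s := by linarith
    rw [hgeom (by linarith) (by linarith), tsum_pow_mul_lintegral_phiNL_zero k₁ k₂ (by linarith),
      lintegral_exp_neg_mul_sq (by linarith), lintegral_exp_neg_mul_sq (by linarith),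
      sub_sub_cancel, ← ENNReal.ofReal_mul (by positivity), ← ENNReal.ofReal_mul (by positivity),
      ← ENNReal.ofReal_mul (by positivity), ENNReal.ofReal_le_ofReal_iff (by positivity)] at h
    have h' := pow_le_pow_left₀ (by positivity) h 2
    rw [mul_pow, mul_pow, mul_pow, Real.sq_sqrt, Real.sq_sqrt] at h'
    · have e : (2 * Real.pi)⁻¹ ^ 2 * (Real.pi / ((1 + 2 * k₂ - (1 - s)) / 2) *
          (Real.pi / ((1 - 2 * k₁ - (1 - s)) / 2))) = ((2 * k₂ + s) * (-2 * k₁ + s))⁻¹ := by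
        rw [show 1 + 2 * k₂ - (1 - s) = 2 * k₂ + s by ring,
          show 1 - 2 * k₁ - (1 - s) = -2 * k₁ + s by ring]
        field_simp
      rw [e, inv_pow, inv_mul_le_iff₀ (by positivity),
        ← div_eq_mul_inv, le_div_iff₀ (by positivity)] at h'
      exact h'
    · exact div_nonneg Real.pi_pos.le (by linarith)
    · exact div_nonneg Real.pi_pos.le (by linarith)
  have key' {s : ℝ} (hs : 0 < s) (hs1 : s ≤ 1) : c ^ 2 * (2 * (k₂ - k₁)) ≤ s := by
    have h := key hs hs1
    have : c ^ 2 * (2 * (k₂ - k₁) * s) ≤ c ^ 2 * ((2 * k₂ + s) * (-2 * k₁ + s)) := by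
      refine mul_le_mul_of_nonneg_left ?_ (sq_nonneg c)
      nlinarith [mul_nonneg h₂ (neg_nonneg.2 h₁), sq_nonneg s]
    have : c ^ 2 * (2 * (k₂ - k₁)) * s ≤ s * s := by nlinarith
    exact le_of_mul_le_mul_right this hs
  have hpos : 0 < c ^ 2 * (2 * (k₂ - k₁)) := by positivity
  have := key' (s := min 1 (c ^ 2 * (2 * (k₂ - k₁)) / 2)) (by positivity) (min_le_left _ _)
  linarith [min_le_right 1 (c ^ 2 * (2 * (k₂ - k₁)) / 2)]

theorem statement13 (k₁ k₂ : ℝ)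
    (hk₁ : -1/2 < k₁ ∧ k₁ < 1/2) (hk₂ : -1/2 < k₂ ∧ k₂ < 1/2)
    (hne : (k₁, k₂) ≠ (0, 0)) :
    ¬ ∃ (e : HilbertBasis (ℕ × ℕ) ℂ (Lp ℂ 2 (volume : Measure (ℝ × ℝ))))
        (V : Lp ℂ 2 (volume : Measure (ℝ × ℝ)) ≃L[ℂ]
              Lp ℂ 2 (volume : Measure (ℝ × ℝ))),
        ∀ n l : ℕ, (V (e (n, l)) : ℝ × ℝ → ℂ) =ᵐ[volume] phiNL k₁ k₂ n l := by
  rintro ⟨e, V, h⟩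
  set A : ℝ := ‖(V.symm : Lp ℂ 2 (volume : Measure (ℝ × ℝ)) →L[ℂ]
      Lp ℂ 2 (volume : Measure (ℝ × ℝ)))‖ with hA
  have he (n : ℕ) : ‖e (n, 0)‖ = 1 := e.orthonormal.1 _
  have hnorm (n : ℕ) : ∫⁻ p, ‖phiNL k₁ k₂ n 0 p‖ₑ ^ 2 = ENNReal.ofReal (‖V (e (n, 0))‖ ^ 2) := by
    rw [ENNReal.ofReal_pow (norm_nonneg _), ofReal_norm, ← lintegral_enorm_sq_eq_enorm_sq]
    exact lintegral_congr_ae ((h n 0).mono fun p hp => by simp only [hp])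
  have hlow (n : ℕ) : 1 ≤ A * ‖V (e (n, 0))‖ := by
    have := (V.symm : Lp ℂ 2 (volume : Measure (ℝ × ℝ)) →L[ℂ]
      Lp ℂ 2 (volume : Measure (ℝ × ℝ))).le_opNorm (V (e (n, 0)))
    simpa [he] using this
  have hApos : 0 < A := (norm_nonneg _).lt_of_ne fun h0 => by
    have := hlow 0
    rw [hA, ← h0] at this
    norm_num at this
  refine not_bounded_lintegral_phiNL_zero hk₁ hk₂ hne (c := A⁻¹ ^ 2)
    (C := ‖(V : Lp ℂ 2 (volume : Measure (ℝ × ℝ)) →L[ℂ]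
      Lp ℂ 2 (volume : Measure (ℝ × ℝ)))‖ ^ 2) (by positivity)
    (fun n => ?_) (fun n => ?_)
  · rw [hnorm]
    gcongr
    rw [inv_le_iff_one_le_mul₀' hApos]
    exact hlow n
  · rw [hnorm]
    gcongr
    simpa [he] using (V : Lp ℂ 2 (volume : Measure (ℝ × ℝ)) →L[ℂ]
      Lp ℂ 2 (volume : Measure (ℝ × ℝ))).le_opNorm (e (n, 0))
end
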